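/- Assume the Notation 3.2 setup. For each natural number n ≥ 1, letting m be such that 2^m ≤ n < 2^{m+1}, define I(n) = {a ∈ A(n) : A(j)·a·A(2^{m+2}−j−n) ⊆ U(2^{m+1})A(2^{m+1}) + A(2^{m+1})U(2^{m+1}) for every j with 0 ≤ j ≤ 2^{m+2}−n}, and set I = ⊕_{n≥1} I(n). Then I is a two-sided ideal of A. -/

import Mathlib

open Module

noncomputable section

/-- The free associative algebra `K⟨x,y⟩` on two generators. -/
abbrev FA (K : Type*) [Field K] := FreeAlgebra K (Fin 2)

/-- The element of `K⟨x,y⟩` given by a word (a list of letters). -/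
def wordOf (K : Type*) [Field K] (l : List (Fin 2)) : FA K :=
  (l.map (FreeAlgebra.ι K)).prod

/-- `a` is a word of length `n` over the two generators. -/
def IsWord (K : Type*) [Field K] (n : ℕ) (a : FA K) : Prop :=
  ∃ l : List (Fin 2), l.length = n ∧ a = wordOf K l

/-- `A(n)`: the span of all words of length `n`. -/
def Aspan (K : Type*) [Field K] (n : ℕ) : Submodule K (FA K) :=
  Submodule.span K {a | IsWord K n a}

/-- The set `T = ∪_{i ≥ 1} {f(i)-g(i)-1, …, f(i)-1}`. -/
def Tset (f g : ℕ → ℕ) : Set ℕ :=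
  {n | ∃ i, 1 ≤ i ∧ f i ≤ n + g i + 1 ∧ n + 1 ≤ f i}

/-- The data and conditions of Notation 3.2 (with the subspaces `U(2^n)`, `V(2^n)`
satisfying conditions (1)–(8) of Proposition 3.1). Here `U n` and `V n` denote the
subspaces `U(2^n)` and `V(2^n)` of `A(2^n)`. -/
structure LSYSetup (K : Type*) [Field K] where
  f : ℕ → ℕ
  g : ℕ → ℕ
  W : ℕ → Submodule K (FA K)
  U : ℕ → Submodule K (FA K)
  V : ℕ → Submodule K (FA K)
  /-- `f(i-1) < f(i) - g(i) - 1` for all `i ≥ 1` -/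
  hf : ∀ i, 1 ≤ i → f (i - 1) + g i + 1 < f i
  /-- `W_i ⊆ A(2^{f(i)})` -/
  hW_le : ∀ i, 1 ≤ i → W i ≤ Aspan K (2 ^ f i)
  /-- `dim W_i ≤ 2^{2^{g(i)}} - 2` -/
  hW_dim : ∀ i, 1 ≤ i → finrank K (W i) ≤ 2 ^ 2 ^ g i - 2
  hU_le : ∀ n, U n ≤ Aspan K (2 ^ n)
  hV_le : ∀ n, V n ≤ Aspan K (2 ^ n)
  /-- (1) `U(2^n) ⊕ V(2^n) = A(2^n)` -/
  h_disj : ∀ n, Disjoint (U n) (V n)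
  h_sup : ∀ n, U n ⊔ V n = Aspan K (2 ^ n)
  /-- (2) `dim V(2^n) = 2` whenever `n ∉ T` -/
  h_dimV : ∀ n, n ∉ Tset f g → finrank K (V n) = 2
  /-- (3) `dim V(2^{n+j}) = 2^{2^j}` whenever `n = f(i)-g(i)-1` and `0 ≤ j ≤ g(i)` -/
  h_dimV' : ∀ i j n, 1 ≤ i → n + g i + 1 = f i → j ≤ g i →
      finrank K (V (n + j)) = 2 ^ 2 ^ j
  /-- (4) `V(2^n)` has a basis consisting of words -/
  h_basis : ∀ n, ∃ s : Set (FA K), (∀ w ∈ s, IsWord K (2 ^ n) w) ∧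
      LinearIndependent K ((↑) : s → FA K) ∧ Submodule.span K s = V n
  /-- (5) `W_i ⊆ U(2^{f(i)})` -/
  hWU : ∀ i, 1 ≤ i → W i ≤ U (f i)
  /-- (6) `A(2^n)U(2^n) + U(2^n)A(2^n) ⊆ U(2^{n+1})` -/
  hU_mul : ∀ n, Aspan K (2 ^ n) * U n ⊔ U n * Aspan K (2 ^ n) ≤ U (n + 1)
  /-- (7) `V(2^{n+1}) ⊆ V(2^n)V(2^n)` -/
  hV_mul : ∀ n, V (n + 1) ≤ V n * V n
  /-- (8) if `n ∉ T` then some word `w ∈ V(2^n)` has `w·A(2^n) ⊆ U(2^{n+1})` -/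
  h_word : ∀ n, n ∉ Tset f g → ∃ w, IsWord K (2 ^ n) w ∧ w ∈ V n ∧
      ∀ a ∈ Aspan K (2 ^ n), w * a ∈ U (n + 1)

variable {K : Type*} [Field K]

/-- `R(n) = {a ∈ A(n) : A(2^{m+1}-n)·a ⊆ U(2^{m+1})}`. -/
def Rspace (S : LSYSetup K) (n m : ℕ) : Submodule K (FA K) where
  carrier := {a | a ∈ Aspan K n ∧ ∀ b ∈ Aspan K (2 ^ (m + 1) - n), b * a ∈ S.U (m + 1)}
  add_mem' := by
    rintro a b ⟨ha1, ha2⟩ ⟨hb1, hb2⟩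
    exact ⟨add_mem ha1 hb1, fun c hc => by
      rw [mul_add]; exact add_mem (ha2 c hc) (hb2 c hc)⟩
  zero_mem' := ⟨zero_mem _, fun c hc => by rw [mul_zero]; exact zero_mem _⟩
  smul_mem' := by
    rintro k a ⟨ha1, ha2⟩
    exact ⟨Submodule.smul_mem _ k ha1, fun c hc => by
      rw [mul_smul_comm]; exact Submodule.smul_mem _ _ (ha2 c hc)⟩

/-- `L(n) = {a ∈ A(n) : a·A(2^{m+1}-n) ⊆ U(2^{m+1})}`. -/
def Lspace (S : LSYSetup K) (n m : ℕ) : Submodule K (FA K) where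
  carrier := {a | a ∈ Aspan K n ∧ ∀ b ∈ Aspan K (2 ^ (m + 1) - n), a * b ∈ S.U (m + 1)}
  add_mem' := by
    rintro a b ⟨ha1, ha2⟩ ⟨hb1, hb2⟩
    exact ⟨add_mem ha1 hb1, fun c hc => by
      rw [add_mul]; exact add_mem (ha2 c hc) (hb2 c hc)⟩
  zero_mem' := ⟨zero_mem _, fun c hc => by rw [zero_mul]; exact zero_mem _⟩
  smul_mem' := by
    rintro k a ⟨ha1, ha2⟩
    exact ⟨Submodule.smul_mem _ k ha1, fun c hc => by
      rw [smul_mul_assoc]; exact Submodule.smul_mem _ _ (ha2 c hc)⟩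

/-- `I(n) = {a ∈ A(n) : A(j)·a·A(2^{m+2}-j-n) ⊆ U(2^{m+1})A(2^{m+1}) + A(2^{m+1})U(2^{m+1})`
for all `0 ≤ j ≤ 2^{m+2}-n}`, where `2^m ≤ n < 2^{m+1}` (i.e. `m = Nat.log 2 n`). -/
def Ispace (S : LSYSetup K) (n : ℕ) : Submodule K (FA K) where
  carrier := {a | a ∈ Aspan K n ∧ ∀ j ≤ 2 ^ (Nat.log 2 n + 2) - n,
      ∀ b ∈ Aspan K j, ∀ c ∈ Aspan K (2 ^ (Nat.log 2 n + 2) - j - n),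
      b * a * c ∈ S.U (Nat.log 2 n + 1) * Aspan K (2 ^ (Nat.log 2 n + 1)) ⊔
        Aspan K (2 ^ (Nat.log 2 n + 1)) * S.U (Nat.log 2 n + 1)}
  add_mem' := by
    rintro a b ⟨ha1, ha2⟩ ⟨hb1, hb2⟩
    refine ⟨add_mem ha1 hb1, fun j hj c hc d hd => ?_⟩
    rw [mul_add, add_mul]
    exact add_mem (ha2 j hj c hc d hd) (hb2 j hj c hc d hd)
  zero_mem' := ⟨zero_mem _, fun j hj c hc d hd => by
    rw [mul_zero, zero_mul]; exact zero_mem _⟩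
  smul_mem' := by
    rintro k a ⟨ha1, ha2⟩
    refine ⟨Submodule.smul_mem _ k ha1, fun j hj c hc d hd => ?_⟩
    rw [mul_smul_comm, smul_mul_assoc]
    exact Submodule.smul_mem _ _ (ha2 j hj c hc d hd)


theorem wordOf_append' (l l' : List (Fin 2)) :
    wordOf K (l ++ l') = wordOf K l * wordOf K l' := by
  simp [wordOf]

theorem Aspan_mul (i j : ℕ) : Aspan K i * Aspan K j = Aspan K (i + j) := by
  unfold Aspan
  rw [Submodule.span_mul_span]
  congr 1
  ext a
  constructor
  · rintro ⟨_, ⟨l, hl, rfl⟩, _, ⟨l', hl', rfl⟩, rfl⟩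
    exact ⟨l ++ l', by simp [hl, hl'], (wordOf_append' l l').symm⟩
  · rintro ⟨l, hl, rfl⟩
    refine ⟨_, ⟨l.take i, by simp; omega, rfl⟩, _, ⟨l.drop i, by simp; omega, rfl⟩, ?_⟩
    change wordOf K _ * wordOf K _ = _
    rw [← wordOf_append', List.take_append_drop]

/-- The target space `U(2^M)A(2^M) + A(2^M)U(2^M)`. -/
def Qspace (S : LSYSetup K) (M : ℕ) : Submodule K (FA K) :=
  S.U M * Aspan K (2 ^ M) ⊔ Aspan K (2 ^ M) * S.U M

/-- Submodule form of the defining property of `I(n)`. -/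
def PProp (S : LSYSetup K) (a : FA K) (n M : ℕ) : Prop :=
  ∀ j k, j + n + k = 2 ^ (M + 2) →
    Aspan K j * Submodule.span K {a} * Aspan K k ≤ Qspace S (M + 1)

theorem Qspace_le_U (S : LSYSetup K) (M : ℕ) : Qspace S M ≤ S.U (M + 1) := by
  rw [Qspace, sup_comm]; exact S.hU_mul M

theorem PProp_step (S : LSYSetup K) (a : FA K) (n M : ℕ) (hn : n < 2 ^ (M + 1))
    (h : PProp S a n M) : PProp S a n (M + 1) := by
  intro j k hjk
  have hs : (2:ℕ) ^ (M + 2) = 2 ^ (M + 1) + 2 ^ (M + 1) := by ring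
  have hs' : (2:ℕ) ^ (M + 1 + 2) = 2 ^ (M + 1) + 2 ^ (M + 1) + 2 ^ (M + 1) + 2 ^ (M + 1) := by ring
  unfold PProp at h
  have hUA : S.U (M + 1) * Aspan K (2 ^ (M + 1)) ≤ S.U (M + 1 + 1) :=
    le_sup_right.trans (S.hU_mul _)
  have hAU : Aspan K (2 ^ (M + 1)) * S.U (M + 1) ≤ S.U (M + 1 + 1) :=
    le_sup_left.trans (S.hU_mul _)
  have hQ := Qspace_le_U S (M + 1)
  have hAA : Aspan K (2 ^ (M + 1 + 1)) = Aspan K (2 ^ (M + 1)) * Aspan K (2 ^ (M + 1)) := by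
    rw [Aspan_mul]; congr 1
  have hgoal : Qspace S (M + 1 + 1) =
      S.U (M + 1 + 1) * (Aspan K (2 ^ (M + 1)) * Aspan K (2 ^ (M + 1))) ⊔
      (Aspan K (2 ^ (M + 1)) * Aspan K (2 ^ (M + 1))) * S.U (M + 1 + 1) := by
    rw [Qspace, hAA]
  rw [hgoal]
  rw [hs] at h
  rw [hs'] at hjk
  have hQs : Qspace S (M + 1) = S.U (M + 1) * Aspan K (2 ^ (M + 1)) ⊔
      Aspan K (2 ^ (M + 1)) * S.U (M + 1) := rfl
  clear hs hs' hgoal hAA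
  generalize 2 ^ (M + 1) = s at *
  rcases lt_or_ge j s with h0 | h0
  · obtain ⟨k', rfl⟩ : ∃ k', k = k' + (s + s) := ⟨k - (s + s), by omega⟩
    rw [← Aspan_mul k', ← Aspan_mul s s, ← mul_assoc]
    exact le_sup_of_le_left (mul_le_mul' ((h j k' (by omega)).trans hQ) le_rfl)
  rcases lt_or_ge j (s + s) with h1 | h1
  · obtain ⟨k', rfl⟩ : ∃ k', k = k' + s := ⟨k - s, by omega⟩
    obtain ⟨j', rfl⟩ : ∃ j', j = s + j' := ⟨j - s, by omega⟩
    rw [← Aspan_mul k', ← Aspan_mul s j']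
    have e := h j' k' (by omega)
    calc _ = Aspan K s * (Aspan K j' * Submodule.span K {a} * Aspan K k') * Aspan K s := by
            simp only [mul_assoc]
      _ ≤ Aspan K s * Qspace S (M + 1) * Aspan K s := by gcongr
      _ = Aspan K s * (S.U (M + 1) * Aspan K s ⊔ Aspan K s * S.U (M + 1)) * Aspan K s := by
            rw [hQs]
      _ = (Aspan K s * S.U (M + 1)) * (Aspan K s * Aspan K s) ⊔
          (Aspan K s * Aspan K s) * (S.U (M + 1) * Aspan K s) := by
            rw [Submodule.mul_sup, Submodule.sup_mul]; simp only [mul_assoc]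
      _ ≤ _ := by gcongr
  · obtain ⟨j', rfl⟩ : ∃ j', j = s + s + j' := ⟨j - (s + s), by omega⟩
    rw [← Aspan_mul (s + s), ← Aspan_mul s s, mul_assoc, mul_assoc, ← mul_assoc (Aspan K j')]
    exact le_sup_of_le_right (mul_le_mul' le_rfl ((h j' k (by omega)).trans hQ))

theorem PProp_mono (S : LSYSetup K) (a : FA K) (n m M : ℕ) (hmM : m ≤ M) (hn : n < 2 ^ (m + 1))
    (h : PProp S a n m) : PProp S a n M := by
  induction M, hmM using Nat.le_induction with
  | base => exact h
  | succ M hM ih =>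
    exact PProp_step S a n M (hn.trans_le (Nat.pow_le_pow_right (by norm_num) (by omega))) ih

theorem mem_Ispace_iff (S : LSYSetup K) (n : ℕ) (a : FA K) :
    a ∈ Ispace S n ↔ a ∈ Aspan K n ∧ PProp S a n (Nat.log 2 n) := by
  have hlt : n < 2 ^ (Nat.log 2 n + 2) :=
    (Nat.lt_pow_succ_log_self (by norm_num) n).trans
      (Nat.pow_lt_pow_right (by norm_num) (by omega))
  change (_ ∧ _) ↔ _
  refine and_congr_right fun _ => ⟨fun h j k hjk => ?_, fun h j hj b hb c hc => ?_⟩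
  · rw [Submodule.mul_le]
    intro x hx c hc
    obtain rfl : k = 2 ^ (Nat.log 2 n + 2) - j - n := by omega
    rw [Submodule.mem_mul_span_singleton] at hx
    obtain ⟨b, hb, rfl⟩ := hx
    exact h j (by omega) b hb c hc
  · exact h j (2 ^ (Nat.log 2 n + 2) - j - n) (by omega)
      (Submodule.mul_mem_mul (Submodule.mul_mem_mul hb (Submodule.mem_span_singleton_self a)) hc)

theorem Ispace_mul (S : LSYSetup K) (n k : ℕ) (a r : FA K) (ha : a ∈ Ispace S n)
    (hr : r ∈ Aspan K k) : r * a ∈ Ispace S (n + k) ∧ a * r ∈ Ispace S (n + k) := by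
  rw [mem_Ispace_iff] at ha
  obtain ⟨ha, hP⟩ := ha
  have hP' := PProp_mono S a n _ (Nat.log 2 (n + k)) (Nat.log_mono_right (by omega))
    (Nat.lt_pow_succ_log_self (by norm_num) n) hP
  have hr' : Submodule.span K {r} ≤ Aspan K k := by simpa using hr
  constructor
  · rw [mem_Ispace_iff]
    refine ⟨by rw [add_comm, ← Aspan_mul]; exact Submodule.mul_mem_mul hr ha, fun i j hij => ?_⟩
    rw [← Set.singleton_mul_singleton, ← Submodule.span_mul_span, ← mul_assoc]
    refine le_trans ?_ (hP' (i + k) j (by omega))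
    rw [← Aspan_mul]
    gcongr
  · rw [mem_Ispace_iff]
    refine ⟨by rw [← Aspan_mul]; exact Submodule.mul_mem_mul ha hr, fun i j hij => ?_⟩
    rw [← Set.singleton_mul_singleton, ← Submodule.span_mul_span, ← mul_assoc, mul_assoc]
    refine le_trans ?_ (hP' i (k + j) (by omega))
    rw [← Aspan_mul]
    gcongr

theorem letter_closed (S : LSYSetup K) (k : ℕ) (r : FA K) (hr : r ∈ Aspan K k) (x : FA K)
    (hx : x ∈ (⨆ n ≥ 1, Ispace S n : Submodule K (FA K))) :
    r * x ∈ (⨆ n ≥ 1, Ispace S n : Submodule K (FA K)) ∧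
      x * r ∈ (⨆ n ≥ 1, Ispace S n : Submodule K (FA K)) := by
  have key : ∀ n ≥ 1, Ispace S n ≤ (⨆ n ≥ 1, Ispace S n : Submodule K (FA K)) :=
    fun n hn => le_iSup₂_of_le n hn le_rfl
  constructor
  · suffices h : (⨆ n ≥ 1, Ispace S n : Submodule K (FA K)) ≤
        (⨆ n ≥ 1, Ispace S n : Submodule K (FA K)).comap (LinearMap.mulLeft K r) from h hx
    refine iSup₂_le fun n hn a ha => ?_
    exact key (n + k) (by omega) (Ispace_mul S n k a r ha hr).1
  · suffices h : (⨆ n ≥ 1, Ispace S n : Submodule K (FA K)) ≤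
        (⨆ n ≥ 1, Ispace S n : Submodule K (FA K)).comap (LinearMap.mulRight K r) from h hx
    refine iSup₂_le fun n hn a ha => ?_
    exact key (n + k) (by omega) (Ispace_mul S n k a r ha hr).2

/-- The ideal `I = ⊕_{n ≥ 1} I(n)` of the proof of Proposition 3.5 is a two-sided
ideal of `A = K⟨x,y⟩` (it is a `K`-subspace by construction, and it is closed under
left and right multiplication by arbitrary elements of `A`). -/
theorem I_is_two_sided_ideal (S : LSYSetup K) :
    ∀ x ∈ (⨆ n ≥ 1, Ispace S n : Submodule K (FA K)), ∀ r : FA K,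
      r * x ∈ (⨆ n ≥ 1, Ispace S n : Submodule K (FA K)) ∧
      x * r ∈ (⨆ n ≥ 1, Ispace S n : Submodule K (FA K)) := by
  intro x hx r
  induction r using FreeAlgebra.induction generalizing x with
  | grade0 c =>
    rw [← Algebra.commutes c x, ← Algebra.smul_def]
    exact ⟨Submodule.smul_mem _ _ hx, Submodule.smul_mem _ _ hx⟩
  | grade1 i =>
    exact letter_closed S 1 _ (Submodule.subset_span ⟨[i], rfl, by simp [wordOf]⟩) x hx
  | mul a b iha ihb =>
    refine ⟨?_, ?_⟩
    · rw [mul_assoc]; exact (iha _ (ihb x hx).1).1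
    · rw [← mul_assoc]; exact (ihb _ (iha x hx).2).2
  | add a b iha ihb =>
    rw [add_mul, mul_add]
    exact ⟨add_mem (iha x hx).1 (ihb x hx).1, add_mem (iha x hx).2 (ihb x hx).2⟩

end
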